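/- arXiv:quant-ph/0412088 — 2 statements merged into one kernel-verified Lean document; each statement's English description precedes it below -/
import Mathlib

section
/- There exist constants ε > 0 and γ > 0 with the following property. For every positive integer n there is a probability distribution ν on {0,1}^n × {0,1}^n with ν(DISJ⁻¹(1)) = ν(DISJ⁻¹(0)) = 1/2, such that for every positive integer k ≤ εn and every family of at most 2^{εn} pairwise disjoint rectangles in ({0,1}^n)^k × ({0,1}^n)^k whose union is the whole space, each rectangle labeled with a vector in {0,1}^k, the ν^k-probability that the label of the rectangle containing ((x₁,…,x_k),(y₁,…,y_k)) equals (DISJ(x₁,y₁),…,DISJ(x_k,y_k)) is at most 2^{-γk}. -/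
open scoped Classical

/-- `DISJ x y = true` iff the sets represented by `x` and `y` are disjoint. -/
def DISJ {n : ℕ} (x y : Fin n → Bool) : Bool :=
  decide (∀ i, ¬(x i = true ∧ y i = true))

/-- Averaging `h` after overwriting coordinate `i` by `b` is conditioning on `z i = b`. -/
lemma sum_update_eq {ι : Type*} [Fintype ι] [DecidableEq ι] (h : (ι → Bool) → ℝ) (i : ι)
    (b : Bool) :
    ∑ z, h (Function.update z i b) = 2 * ∑ z, if z i = b then h z else 0 := by
  have hinv : Function.Involutive (fun z : ι → Bool => Function.update z i (!z i)) := by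
    intro z
    simp
  have hflip : ∑ z, (if z i = b then h z else 0)
      = ∑ z, if z i = b then 0 else h (Function.update z i b) := by
    rw [← Equiv.sum_comp (Function.Involutive.toPerm _ hinv)]
    refine Finset.sum_congr rfl fun z _ => ?_
    change (if Function.update z i (!z i) i = b then h (Function.update z i (!z i)) else 0) = _
    cases hz : z i <;> cases b <;> simp
  rw [two_mul]
  nth_rewrite 2 [hflip]
  rw [← Finset.sum_add_distrib]
  refine Finset.sum_congr rfl fun z _ => ?_
  split_ifs with hz
  · subst hz; simp
  · simp

lemma two_mul_sum_eq_sum_update {ι : Type*} [Fintype ι] [DecidableEq ι]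
    (h : (ι → Bool) → ℝ) (i : ι) :
    2 * ∑ z, h z = ∑ z, (h (Function.update z i true) + h (Function.update z i false)) := by
  rw [Finset.sum_add_distrib, sum_update_eq, sum_update_eq, ← mul_add, ← Finset.sum_add_distrib]
  congr 1
  refine Finset.sum_congr rfl fun z _ => ?_
  cases z i <;> simp

lemma one_add_exp_neg_one_le : 1 + Real.exp (-1) ≤ 2 * Real.exp (-(7 / 20)) := by
  have h1 : Real.exp (-1) ≤ 0.37 := by
    rw [Real.exp_neg, inv_le_comm₀ (Real.exp_pos _) (by norm_num)]
    have := Real.exp_one_gt_d9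
    norm_num at this ⊢
    linarith
  have h2 : Real.exp (7 / 20) ≤ 1.45 := by
    refine le_of_pow_le_pow_left₀ (n := 20) (by norm_num) (by norm_num) ?_
    rw [← Real.exp_nat_mul]
    have : Real.exp (((20 : ℕ) : ℝ) * (7 / 20)) = Real.exp 1 ^ 7 := by
      rw [← Real.exp_nat_mul]; norm_num
    rw [this]
    calc Real.exp 1 ^ 7 ≤ 2.7182818286 ^ 7 := by
          gcongr
          exact Real.exp_one_lt_d9.le
      _ ≤ _ := by norm_num
  have h3 : (1.45 : ℝ)⁻¹ ≤ Real.exp (-(7 / 20)) := by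
    rw [Real.exp_neg]
    gcongr
  norm_num at h1 h3
  linarith

/-- A nonnegative function on the cube bounded by one, under whose normalisation every coordinate
in `I` takes the value `σ i` with probability at most a quarter, has small mean. -/
lemma sum_le_of_biased {ι : Type*} [Fintype ι] [DecidableEq ι] (h : (ι → Bool) → ℝ)
    (h0 : ∀ z, 0 ≤ h z) (h1 : ∀ z, h z ≤ 1) (I : Finset ι) (σ : ι → Bool)
    (hI : ∀ i ∈ I, 4 * (∑ z, if z i = σ i then h z else 0) ≤ ∑ z, h z) :
    ∑ z, h z ≤ Real.exp (-(I.card / 10)) * 2 ^ Fintype.card ι := by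
  set s : (ι → Bool) → ℝ := fun z => ∑ i ∈ I, if z i = σ i then 1 else 0 with hs
  have hmean : 4 * ∑ z, h z * s z ≤ I.card * ∑ z, h z := by
    have : ∑ z, h z * s z = ∑ i ∈ I, ∑ z, if z i = σ i then h z else 0 := by
      rw [Finset.sum_comm]
      refine Finset.sum_congr rfl fun z _ => ?_
      rw [hs, Finset.mul_sum]
      simp
    rw [this, Finset.mul_sum, ← nsmul_eq_mul, ← Finset.sum_const]
    exact Finset.sum_le_sum hI
  have hlow : Real.exp (-(I.card / 4)) * ∑ z, h z ≤ ∑ z, h z * Real.exp (-s z) := by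
    have hpt : ∀ z, Real.exp (-(I.card / 4)) * (h z * (1 - s z + I.card / 4))
        ≤ h z * Real.exp (-s z) := by
      intro z
      have h2 : Real.exp (-s z) = Real.exp (-(I.card / 4)) * Real.exp (I.card / 4 - s z) := by
        rw [← Real.exp_add]; congr 1; ring
      rw [h2, mul_left_comm]
      have := Real.add_one_le_exp (I.card / 4 - s z)
      have h3 := h0 z
      gcongr
      linarith
    refine le_trans ?_ (Finset.sum_le_sum fun z _ => hpt z)
    rw [← Finset.mul_sum]
    refine mul_le_mul_of_nonneg_left ?_ (Real.exp_pos _).le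
    have : ∑ z, h z * (1 - s z + I.card / 4)
        = ∑ z, h z - ∑ z, h z * s z + I.card / 4 * ∑ z, h z := by
      rw [Finset.mul_sum, ← Finset.sum_sub_distrib, ← Finset.sum_add_distrib]
      refine Finset.sum_congr rfl fun z _ => ?_
      ring
    rw [this]
    linarith
  have hprod : ∑ z, Real.exp (-s z)
      = (1 + Real.exp (-1)) ^ I.card * 2 ^ (Fintype.card ι - I.card) := by
    have hz : ∀ z : ι → Bool, Real.exp (-s z)
        = ∏ i, if i ∈ I then (if z i = σ i then Real.exp (-1) else 1) else 1 := by
      intro z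
      rw [Finset.prod_ite_mem, Finset.univ_inter, hs, ← Finset.sum_neg_distrib, Real.exp_sum]
      refine Finset.prod_congr rfl fun i _ => ?_
      split_ifs <;> simp
    simp_rw [hz]
    rw [← Fintype.prod_sum (fun i (b : Bool) =>
      if i ∈ I then (if b = σ i then Real.exp (-1) else (1 : ℝ)) else 1)]
    have hi : ∀ i, (∑ b : Bool, if i ∈ I then (if b = σ i then Real.exp (-1) else (1 : ℝ)) else 1)
        = if i ∈ I then 1 + Real.exp (-1) else 2 := by
      intro i
      cases σ i <;> by_cases hi : i ∈ I <;> simp [hi, add_comm]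
    simp_rw [hi]
    rw [Finset.prod_ite]
    simp [Finset.filter_not, Finset.card_sdiff]
  have hup : ∑ z, h z * Real.exp (-s z)
      ≤ Real.exp (-(7 / 20) * I.card) * 2 ^ Fintype.card ι := by
    calc ∑ z, h z * Real.exp (-s z) ≤ ∑ z, Real.exp (-s z) := by
          refine Finset.sum_le_sum fun z _ => ?_
          exact mul_le_of_le_one_left (Real.exp_pos _).le (h1 z)
      _ = (1 + Real.exp (-1)) ^ I.card * 2 ^ (Fintype.card ι - I.card) := hprod
      _ ≤ (2 * Real.exp (-(7 / 20))) ^ I.card * 2 ^ (Fintype.card ι - I.card) := by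
          gcongr
          exact one_add_exp_neg_one_le
      _ = _ := by
          have hc : I.card ≤ Fintype.card ι := Finset.card_le_univ I
          rw [mul_pow, ← Real.exp_nat_mul, mul_comm (I.card : ℝ),
            mul_right_comm, ← pow_add, Nat.add_sub_cancel' hc, mul_comm]
  have key := hlow.trans hup
  rw [mul_comm, ← le_div_iff₀ (Real.exp_pos _)] at key
  refine key.trans_eq ?_
  rw [mul_div_right_comm, ← Real.exp_sub]
  congr 2
  ring

lemma compl_update {ι : Type*} [DecidableEq ι] (T : ι → Bool) (i : ι) (c : Bool) :
    (Function.update T i c)ᶜ = Function.update Tᶜ i (!c) := by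
  ext j
  by_cases hj : j = i
  · subst hj; simp
  · simp [hj]

/-- Sum of `f` over the subcube of subsets of `T`. -/
noncomputable def subcubeSum {ι : Type*} [Fintype ι] [DecidableEq ι]
    (f : (ι → Bool) → ℝ) (T : ι → Bool) : ℝ :=
  ∑ z, f (z ⊓ T)

/-- Sum of `f` over the subcube of subsets of `T`, with coordinate `i` overwritten by `b`. -/
noncomputable def fixedSum {ι : Type*} [Fintype ι] [DecidableEq ι]
    (f : (ι → Bool) → ℝ) (T : ι → Bool) (i : ι) (b : Bool) : ℝ :=
  ∑ z, f (Function.update (z ⊓ T) i b)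

/-- Coordinate `i` takes one of its two values with conditional probability below a quarter. -/
def Biased {ι : Type*} [Fintype ι] [DecidableEq ι]
    (f : (ι → Bool) → ℝ) (T : ι → Bool) (i : ι) : Prop :=
  ∃ b, 4 * fixedSum f T i b < fixedSum f T i true + fixedSum f T i false

section Subcube

variable {ι : Type*} [Fintype ι] [DecidableEq ι] (f g : (ι → Bool) → ℝ) (T : ι → Bool) (i : ι)

lemma fixedSum_update (b c : Bool) : fixedSum f (Function.update T i c) i b = fixedSum f T i b := by
  refine Finset.sum_congr rfl fun z _ => ?_
  congr 1
  ext j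
  by_cases hj : j = i
  · subst hj; simp
  · simp [hj]

lemma biased_update (c : Bool) : Biased f (Function.update T i c) i ↔ Biased f T i := by
  simp only [Biased, fixedSum_update]

lemma subcubeSum_of_false (hi : T i = false) : subcubeSum f T = fixedSum f T i false := by
  refine Finset.sum_congr rfl fun z _ => ?_
  congr 1
  ext j
  by_cases hj : j = i
  · subst hj; simp [hi]
  · simp [hj]

lemma fixedSum_of_true (hi : T i = true) (b : Bool) :
    fixedSum f T i b = 2 * ∑ z, if z i = b then f (z ⊓ T) else 0 := by
  rw [← sum_update_eq (fun z => f (z ⊓ T))]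
  refine Finset.sum_congr rfl fun z _ => ?_
  congr 1
  ext j
  by_cases hj : j = i
  · subst hj; simp [hi]
  · simp [hj]

lemma subcubeSum_of_true (hi : T i = true) :
    2 * subcubeSum f T = fixedSum f T i true + fixedSum f T i false := by
  rw [fixedSum_of_true f T i hi, fixedSum_of_true f T i hi, ← mul_add, ← Finset.sum_add_distrib,
    subcubeSum]
  congr 1
  refine Finset.sum_congr rfl fun z _ => ?_
  cases z i <;> simp

variable {f g}

lemma fixedSum_nonneg (h0 : ∀ z, 0 ≤ f z) (b : Bool) : 0 ≤ fixedSum f T i b :=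
  Finset.sum_nonneg fun _ _ => h0 _

lemma subcubeSum_nonneg (h0 : ∀ z, 0 ≤ f z) : 0 ≤ subcubeSum f T :=
  Finset.sum_nonneg fun _ _ => h0 _

lemma subcubeSum_le (h1 : ∀ z, f z ≤ 1) : subcubeSum f T ≤ 2 ^ Fintype.card ι := by
  refine (Finset.sum_le_sum fun z _ => h1 _).trans_eq ?_
  simp

lemma subcubeSum_le_of_biased (h0 : ∀ z, 0 ≤ f z) (h1 : ∀ z, f z ≤ 1) :
    subcubeSum f T ≤ Real.exp (-((Finset.univ.filter fun i => T i = true ∧ Biased f T i).card / 10))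
      * 2 ^ Fintype.card ι := by
  have hex : ∀ i, ∃ b, Biased f T i →
      4 * fixedSum f T i b < fixedSum f T i true + fixedSum f T i false := by
    intro i
    by_cases h : Biased f T i
    · obtain ⟨b, hb⟩ := h
      exact ⟨b, fun _ => hb⟩
    · exact ⟨true, fun h' => absurd h' h⟩
  choose σ hσ using hex
  refine sum_le_of_biased (fun z => f (z ⊓ T)) (fun _ => h0 _) (fun _ => h1 _) _ σ ?_
  intro i hi
  obtain ⟨hT, hb⟩ := (Finset.mem_filter.mp hi).2
  have := hσ i hb
  rw [← subcubeSum_of_true f T i hT, fixedSum_of_true f T i hT] at this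
  rw [subcubeSum] at this
  linarith

lemma subcubeSum_mul_biased_card_le (h0 : ∀ z, 0 ≤ f z) (h1 : ∀ z, f z ≤ 1) :
    subcubeSum f T * (Finset.univ.filter fun i => T i = true ∧ Biased f T i).card
      ≤ Fintype.card ι / 20 * subcubeSum f T
        + Fintype.card ι * (Real.exp (-(Fintype.card ι / 200)) * 2 ^ Fintype.card ι) := by
  have hle := subcubeSum_le_of_biased T h0 h1
  have hp := subcubeSum_nonneg T h0
  set c := (Finset.univ.filter fun i => T i = true ∧ Biased f T i).card
  have hc : (c : ℝ) ≤ Fintype.card ι := by exact_mod_cast Finset.card_le_univ _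
  by_cases h : (c : ℝ) ≤ Fintype.card ι / 20
  · have : subcubeSum f T * c ≤ subcubeSum f T * (Fintype.card ι / 20) := by gcongr
    have : 0 ≤ Fintype.card ι * (Real.exp (-(Fintype.card ι / 200)) * 2 ^ Fintype.card ι) := by
      positivity
    linarith
  · have h2 : subcubeSum f T ≤ Real.exp (-(Fintype.card ι / 200)) * 2 ^ Fintype.card ι := by
      refine hle.trans ?_
      push Not at h
      refine mul_le_mul_of_nonneg_right (Real.exp_le_exp.mpr ?_) (by positivity)
      linarith
    have h3 : subcubeSum f T * c
        ≤ (Real.exp (-(Fintype.card ι / 200)) * 2 ^ Fintype.card ι) * Fintype.card ι := by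
      gcongr
    have : 0 ≤ Fintype.card ι / 20 * subcubeSum f T := by positivity
    linarith

/-- Pointwise form of the corruption bound, with `a₀, a₁, b₀, b₁` the conditional weights. -/
lemma corruption_pointwise {a₀ a₁ b₀ b₁ : ℝ} (ha₀ : 0 ≤ a₀) (ha₁ : 0 ≤ a₁) (hb₀ : 0 ≤ b₀)
    (hb₁ : 0 ≤ b₁) {u v : Prop} (hu : ¬u → a₁ ≤ 3 * a₀ ∧ a₀ ≤ 3 * a₁)
    (hv : ¬v → b₁ ≤ 3 * b₀ ∧ b₀ ≤ 3 * b₁) :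
    (a₁ + a₀) / 2 * b₀ + a₀ * ((b₁ + b₀) / 2) ≤ 36 * (a₁ * b₁)
      + 5 * (if u then (a₁ + a₀) / 2 * b₀ else 0)
      + 5 * (if v then a₀ * ((b₁ + b₀) / 2) else 0) := by
  have h11 := mul_nonneg ha₁ hb₁
  have h10 := mul_nonneg ha₁ hb₀
  have h01 := mul_nonneg ha₀ hb₁
  have h00 := mul_nonneg ha₀ hb₀
  by_cases cu : u <;> by_cases cv : v <;> simp only [cu, cv, if_true, if_false]
  · linarith
  · have := mul_le_mul_of_nonneg_left (hv cv).1 ha₀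
    linarith
  · have := mul_le_mul_of_nonneg_right (hu cu).1 hb₀
    linarith
  · have e1 := mul_le_mul_of_nonneg_right (hu cu).1 hb₀
    have e2 := mul_le_mul_of_nonneg_left (hv cv).1 ha₀
    have e3 := mul_le_mul_of_nonneg_right (hu cu).2 hb₀
    have e4 := mul_le_mul_of_nonneg_left (hv cv).2 ha₁
    linarith

lemma bounds_of_not_biased (h : ¬Biased f T i) :
    fixedSum f T i true ≤ 3 * fixedSum f T i false ∧
      fixedSum f T i false ≤ 3 * fixedSum f T i true := by
  simp only [Biased, not_exists, not_lt] at h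
  have h1 := h true
  have h2 := h false
  constructor <;> linarith

lemma sum_mul_le_coordinate (hf : ∀ z, 0 ≤ f z) (hg : ∀ z, 0 ≤ g z) :
    ∑ T, subcubeSum f T * subcubeSum g Tᶜ
      ≤ 18 * ∑ T, fixedSum f T i true * fixedSum g Tᶜ i true
        + 5 * (∑ T, if T i = true ∧ Biased f T i then subcubeSum f T * subcubeSum g Tᶜ else 0)
        + 5 * (∑ T, if Tᶜ i = true ∧ Biased g Tᶜ i
            then subcubeSum f T * subcubeSum g Tᶜ else 0) := by
  have hP : ∀ T, subcubeSum f (Function.update T i true)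
        * subcubeSum g (Function.update T i true)ᶜ
      = (fixedSum f T i true + fixedSum f T i false) / 2 * fixedSum g Tᶜ i false := by
    intro T
    rw [compl_update, subcubeSum_of_false g _ i (by simp)]
    have := subcubeSum_of_true f (Function.update T i true) i (by simp)
    simp only [fixedSum_update, Bool.not_true] at this ⊢
    rw [← this]
    ring
  have hQ : ∀ T, subcubeSum f (Function.update T i false)
        * subcubeSum g (Function.update T i false)ᶜ
      = fixedSum f T i false * ((fixedSum g Tᶜ i true + fixedSum g Tᶜ i false) / 2) := by
    intro T
    rw [compl_update, subcubeSum_of_false f _ i (by simp)]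
    have := subcubeSum_of_true g (Function.update Tᶜ i true) i (by simp)
    simp only [fixedSum_update, Bool.not_false] at this ⊢
    rw [← this]
    ring
  have hbf : 2 * (∑ T, if T i = true ∧ Biased f T i then subcubeSum f T * subcubeSum g Tᶜ else 0)
      = ∑ T, if Biased f T i then
        (fixedSum f T i true + fixedSum f T i false) / 2 * fixedSum g Tᶜ i false else 0 := by
    simp_rw [ite_and]
    rw [← sum_update_eq (fun T => if Biased f T i then subcubeSum f T * subcubeSum g Tᶜ else 0)]
    simp only [biased_update, hP]
  have hbg : 2 * (∑ T, if Tᶜ i = true ∧ Biased g Tᶜ i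
        then subcubeSum f T * subcubeSum g Tᶜ else 0)
      = ∑ T, if Biased g Tᶜ i then
        fixedSum f T i false * ((fixedSum g Tᶜ i true + fixedSum g Tᶜ i false) / 2) else 0 := by
    have hc : ∀ T : ι → Bool, (Tᶜ i = true) = (T i = false) := by
      intro T; simp
    simp_rw [ite_and, hc]
    rw [← sum_update_eq (fun T => if Biased g Tᶜ i then subcubeSum f T * subcubeSum g Tᶜ else 0)]
    simp only [hQ]
    simp only [compl_update, biased_update]
  have hpt := Finset.sum_le_sum fun (T : ι → Bool) (_ : T ∈ Finset.univ) =>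
    corruption_pointwise (fixedSum_nonneg T i hf false) (fixedSum_nonneg T i hf true)
      (fixedSum_nonneg Tᶜ i hg false) (fixedSum_nonneg Tᶜ i hg true)
      (bounds_of_not_biased T i (f := f)) (bounds_of_not_biased Tᶜ i (f := g))
  have htot := two_mul_sum_eq_sum_update (fun T => subcubeSum f T * subcubeSum g Tᶜ) i
  simp only [hP, hQ] at htot
  rw [← htot, Finset.sum_add_distrib, Finset.sum_add_distrib, ← Finset.mul_sum, ← Finset.mul_sum,
    ← Finset.mul_sum, ← hbf, ← hbg] at hpt
  linarith

lemma sum_mul_biased_le (hf0 : ∀ z, 0 ≤ f z) (hf1 : ∀ z, f z ≤ 1) (hg0 : ∀ z, 0 ≤ g z)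
    (hg1 : ∀ z, g z ≤ 1) :
    ∑ i, ∑ T, (if T i = true ∧ Biased f T i then subcubeSum f T * subcubeSum g Tᶜ else 0)
      ≤ Fintype.card ι / 20 * ∑ T, subcubeSum f T * subcubeSum g Tᶜ
        + Fintype.card ι * (Real.exp (-(Fintype.card ι / 200)) * 8 ^ Fintype.card ι) := by
  rw [Finset.sum_comm]
  have hT : ∀ T, ∑ i, (if T i = true ∧ Biased f T i then subcubeSum f T * subcubeSum g Tᶜ else 0)
      ≤ Fintype.card ι / 20 * (subcubeSum f T * subcubeSum g Tᶜ)
        + Fintype.card ι * (Real.exp (-(Fintype.card ι / 200)) * 4 ^ Fintype.card ι) := by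
    intro T
    rw [← Finset.sum_filter, Finset.sum_const, nsmul_eq_mul]
    have h1 := subcubeSum_mul_biased_card_le T hf0 hf1
    have h2 := mul_le_mul_of_nonneg_right h1 (subcubeSum_nonneg Tᶜ hg0)
    have h3 : Fintype.card ι * (Real.exp (-(Fintype.card ι / 200)) * 2 ^ Fintype.card ι)
        * subcubeSum g Tᶜ
        ≤ Fintype.card ι * (Real.exp (-(Fintype.card ι / 200)) * 2 ^ Fintype.card ι)
          * 2 ^ Fintype.card ι := by
      gcongr
      exact subcubeSum_le _ hg1
    have h4 : (4 : ℝ) ^ Fintype.card ι = 2 ^ Fintype.card ι * 2 ^ Fintype.card ι := by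
      rw [← mul_pow]; norm_num
    rw [h4]
    linarith
  refine (Finset.sum_le_sum fun T _ => hT T).trans_eq ?_
  rw [Finset.sum_add_distrib, ← Finset.mul_sum, Finset.sum_const, nsmul_eq_mul]
  have h8 : (8 : ℝ) ^ Fintype.card ι = 2 ^ Fintype.card ι * 4 ^ Fintype.card ι := by
    rw [← mul_pow]; norm_num
  rw [h8]
  simp
  ring

/-- Corruption bound for disjointness, in unnormalised form. -/
lemma corruption_bound [Nonempty ι] (hf0 : ∀ z, 0 ≤ f z) (hf1 : ∀ z, f z ≤ 1)
    (hg0 : ∀ z, 0 ≤ g z) (hg1 : ∀ z, g z ≤ 1) :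
    ∑ T, subcubeSum f T * subcubeSum g Tᶜ
      ≤ 36 * ((∑ i, ∑ T, fixedSum f T i true * fixedSum g Tᶜ i true) / Fintype.card ι)
        + 20 * (Real.exp (-(Fintype.card ι / 200)) * 8 ^ Fintype.card ι) := by
  have hsum := Finset.sum_le_sum fun (i : ι) (_ : i ∈ Finset.univ) =>
    sum_mul_le_coordinate i hf0 hg0
  have hf := sum_mul_biased_le hf0 hf1 hg0 hg1
  have hg := sum_mul_biased_le hg0 hg1 hf0 hf1
  have hcompl : ∀ h : (ι → Bool) → ℝ, ∑ T, h Tᶜ = ∑ T, h T := fun h =>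
    Equiv.sum_comp (Function.Involutive.toPerm compl (compl_involutive)) h
  have hg' : ∑ i, ∑ T, (if Tᶜ i = true ∧ Biased g Tᶜ i
        then subcubeSum f T * subcubeSum g Tᶜ else 0)
      = ∑ i, ∑ T, (if T i = true ∧ Biased g T i then subcubeSum g T * subcubeSum f Tᶜ else 0) := by
    refine Finset.sum_congr rfl fun i _ => ?_
    rw [← hcompl (fun T => if T i = true ∧ Biased g T i
      then subcubeSum g T * subcubeSum f Tᶜ else 0)]
    simp only [compl_compl, mul_comm]
  have hg'' : ∑ T, subcubeSum g T * subcubeSum f Tᶜ = ∑ T, subcubeSum f T * subcubeSum g Tᶜ := by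
    rw [← hcompl]
    simp only [compl_compl, mul_comm]
  rw [Finset.sum_const, Finset.card_univ, nsmul_eq_mul, Finset.sum_add_distrib,
    Finset.sum_add_distrib, ← Finset.mul_sum, ← Finset.mul_sum, ← Finset.mul_sum, hg'] at hsum
  rw [hg''] at hg
  have hn : (0 : ℝ) < Fintype.card ι := by exact_mod_cast Fintype.card_pos
  have hfin : (Fintype.card ι : ℝ) * ∑ T, subcubeSum f T * subcubeSum g Tᶜ
      ≤ Fintype.card ι * (36 * ((∑ i, ∑ T, fixedSum f T i true * fixedSum g Tᶜ i true)
        / Fintype.card ι) + 20 * (Real.exp (-(Fintype.card ι / 200)) * 8 ^ Fintype.card ι)) := by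
    have : (Fintype.card ι : ℝ) * (36 * ((∑ i, ∑ T, fixedSum f T i true * fixedSum g Tᶜ i true)
        / Fintype.card ι) + 20 * (Real.exp (-(Fintype.card ι / 200)) * 8 ^ Fintype.card ι))
      = 36 * (∑ i, ∑ T, fixedSum f T i true * fixedSum g Tᶜ i true)
        + 20 * (Fintype.card ι * (Real.exp (-(Fintype.card ι / 200)) * 8 ^ Fintype.card ι)) := by
      field_simp
    rw [this]
    linarith
  exact le_of_mul_le_mul_left hfin hn

end Subcube

/-- If each `μ t` is dominated by `ρ` up to `θ` on single-coordinate rectangles, then the product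
of the `μ t` is dominated by the power of `ρ` up to `k * θ` on rectangles. -/
lemma sum_rectangle_prod_le {X Y : Type*} [Fintype X] [Fintype Y] (ρ : X × Y → ℝ) (θ : ℝ)
    (hρ : ∀ c, 0 ≤ ρ c) (hρ1 : ∑ c, ρ c ≤ 1) (hθ : 0 ≤ θ) (k : ℕ) (μ : Fin k → X × Y → ℝ)
    (hμ : ∀ t c, 0 ≤ μ t c) (hμ1 : ∀ t, ∑ c, μ t c ≤ 1)
    (hdom : ∀ t (f : X → ℝ) (g : Y → ℝ), (∀ x, 0 ≤ f x) → (∀ x, f x ≤ 1) → (∀ y, 0 ≤ g y) →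
      (∀ y, g y ≤ 1) → ∑ c, f c.1 * g c.2 * μ t c ≤ ∑ c, f c.1 * g c.2 * ρ c + θ)
    (F : (Fin k → X) → ℝ) (G : (Fin k → Y) → ℝ) (hF0 : ∀ x, 0 ≤ F x) (hF1 : ∀ x, F x ≤ 1)
    (hG0 : ∀ y, 0 ≤ G y) (hG1 : ∀ y, G y ≤ 1) :
    ∑ q : Fin k → X × Y, F (fun t => (q t).1) * G (fun t => (q t).2) * ∏ t, μ t (q t)
      ≤ ∑ q : Fin k → X × Y, F (fun t => (q t).1) * G (fun t => (q t).2) * ∏ t, ρ (q t)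
        + k * θ := by
  induction k with
  | zero => simp
  | succ k ih =>
    have hfst : ∀ (c : X × Y) (q : Fin k → X × Y),
        (fun t => ((Fin.cons c q : Fin (k + 1) → X × Y) t).1)
          = (Fin.cons c.1 (fun t => (q t).1) : Fin (k + 1) → X) := by
      intro c q
      ext t
      refine Fin.cases ?_ (fun t => ?_) t <;> simp
    have hsnd : ∀ (c : X × Y) (q : Fin k → X × Y),
        (fun t => ((Fin.cons c q : Fin (k + 1) → X × Y) t).2)
          = (Fin.cons c.2 (fun t => (q t).2) : Fin (k + 1) → Y) := by
      intro c q
      ext t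
      refine Fin.cases ?_ (fun t => ?_) t <;> simp
    have hsplit : ∀ m : Fin (k + 1) → X × Y → ℝ,
        ∑ q : Fin (k + 1) → X × Y, F (fun t => (q t).1) * G (fun t => (q t).2) * ∏ t, m t (q t)
        = ∑ c : X × Y, ∑ q : Fin k → X × Y, F (Fin.cons c.1 (fun t => (q t).1))
            * G (Fin.cons c.2 (fun t => (q t).2)) * (m 0 c * ∏ t, m (Fin.succ t) (q t)) := by
      intro m
      rw [← Equiv.sum_comp (Fin.consEquiv (fun _ => X × Y)), Fintype.sum_prod_type]
      refine Finset.sum_congr rfl fun c _ => Finset.sum_congr rfl fun q _ => ?_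
      simp only [Fin.consEquiv_apply, hfst, hsnd, Fin.prod_univ_succ, Fin.cons_zero, Fin.cons_succ]
    have hhead : ∀ q : Fin k → X × Y,
        (∑ c : X × Y, F (Fin.cons c.1 (fun t => (q t).1)) * G (Fin.cons c.2 (fun t => (q t).2))
          * μ 0 c) * ∏ t, μ (Fin.succ t) (q t)
        ≤ (∑ c : X × Y, F (Fin.cons c.1 (fun t => (q t).1)) * G (Fin.cons c.2 (fun t => (q t).2))
          * ρ c + θ) * ∏ t, μ (Fin.succ t) (q t) := by
      intro q
      refine mul_le_mul_of_nonneg_right ?_ (Finset.prod_nonneg fun t _ => hμ _ _)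
      exact hdom 0 (fun x => F (Fin.cons x (fun t => (q t).1)))
        (fun y => G (Fin.cons y (fun t => (q t).2))) (fun _ => hF0 _) (fun _ => hF1 _)
        (fun _ => hG0 _) (fun _ => hG1 _)
    have htail : ∀ c : X × Y, ρ c * ∑ q : Fin k → X × Y, F (Fin.cons c.1 (fun t => (q t).1))
            * G (Fin.cons c.2 (fun t => (q t).2)) * ∏ t, μ (Fin.succ t) (q t)
        ≤ ρ c * (∑ q : Fin k → X × Y, F (Fin.cons c.1 (fun t => (q t).1))
            * G (Fin.cons c.2 (fun t => (q t).2)) * ∏ t, ρ (q t) + k * θ) := by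
      intro c
      refine mul_le_mul_of_nonneg_left ?_ (hρ c)
      exact ih (fun t => μ t.succ) (fun t => hμ _) (fun t => hμ1 _) (fun t => hdom _)
        (fun x => F (Fin.cons c.1 x)) (fun y => G (Fin.cons c.2 y)) (fun _ => hF0 _)
        (fun _ => hF1 _) (fun _ => hG0 _) (fun _ => hG1 _)
    have hmass : ∑ q : Fin k → X × Y, ∏ t, μ (Fin.succ t) (q t) ≤ 1 := by
      rw [← Fintype.prod_sum (fun t c => μ (Fin.succ t) c)]
      exact Finset.prod_le_one (fun t _ => Finset.sum_nonneg fun c _ => hμ _ _) fun t _ => hμ1 _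
    rw [hsplit μ, hsplit fun _ => ρ]
    calc _ = ∑ q : Fin k → X × Y, (∑ c : X × Y, F (Fin.cons c.1 (fun t => (q t).1))
          * G (Fin.cons c.2 (fun t => (q t).2)) * μ 0 c) * ∏ t, μ (Fin.succ t) (q t) := by
          rw [Finset.sum_comm]
          refine Finset.sum_congr rfl fun q _ => ?_
          rw [Finset.sum_mul]
          refine Finset.sum_congr rfl fun c _ => ?_
          ring
      _ ≤ ∑ q : Fin k → X × Y, (∑ c : X × Y, F (Fin.cons c.1 (fun t => (q t).1))
          * G (Fin.cons c.2 (fun t => (q t).2)) * ρ c + θ) * ∏ t, μ (Fin.succ t) (q t) :=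
          Finset.sum_le_sum fun q _ => hhead q
      _ = ∑ c : X × Y, ρ c * (∑ q : Fin k → X × Y, F (Fin.cons c.1 (fun t => (q t).1))
            * G (Fin.cons c.2 (fun t => (q t).2)) * ∏ t, μ (Fin.succ t) (q t))
          + θ * ∑ q : Fin k → X × Y, ∏ t, μ (Fin.succ t) (q t) := by
          simp_rw [add_mul]
          rw [Finset.sum_add_distrib, Finset.mul_sum]
          congr 1
          simp_rw [Finset.sum_mul, Finset.mul_sum]
          rw [Finset.sum_comm]
          refine Finset.sum_congr rfl fun c _ => Finset.sum_congr rfl fun q _ => ?_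
          ring
      _ ≤ ∑ c : X × Y, ρ c * (∑ q : Fin k → X × Y, F (Fin.cons c.1 (fun t => (q t).1))
            * G (Fin.cons c.2 (fun t => (q t).2)) * ∏ t, ρ (q t) + k * θ) + θ * 1 := by
          refine add_le_add (Finset.sum_le_sum fun c _ => htail c) ?_
          gcongr
      _ = ∑ c : X × Y, ρ c * (∑ q : Fin k → X × Y, F (Fin.cons c.1 (fun t => (q t).1))
            * G (Fin.cons c.2 (fun t => (q t).2)) * ∏ t, ρ (q t)) + (∑ c, ρ c) * (k * θ) + θ := by
          simp_rw [mul_add]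
          rw [Finset.sum_add_distrib, Finset.sum_mul, mul_one]
      _ ≤ ∑ c : X × Y, ρ c * (∑ q : Fin k → X × Y, F (Fin.cons c.1 (fun t => (q t).1))
            * G (Fin.cons c.2 (fun t => (q t).2)) * ∏ t, ρ (q t)) + 1 * (k * θ) + θ := by
          gcongr
      _ = _ := by
          push_cast
          rw [add_assoc]
          congr 1
          · simp_rw [Finset.mul_sum]
            refine Finset.sum_congr rfl fun c _ => Finset.sum_congr rfl fun q _ => ?_
            ring
          · ring

/-- The distribution of `φ ω` for uniformly random `ω`. -/
noncomputable def uniformImage {Ω α : Type*} [Fintype Ω] (φ : Ω → α) (a : α) : ℝ :=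
  (∑ ω, if φ ω = a then 1 else 0) / Fintype.card Ω

lemma uniformImage_nonneg {Ω α : Type*} [Fintype Ω] (φ : Ω → α) (a : α) :
    0 ≤ uniformImage φ a :=
  div_nonneg (Finset.sum_nonneg fun _ _ => by split_ifs <;> norm_num) (Nat.cast_nonneg _)

lemma sum_mul_uniformImage {Ω α : Type*} [Fintype Ω] [Fintype α] (φ : Ω → α) (h : α → ℝ) :
    ∑ a, h a * uniformImage φ a = (∑ ω, h (φ ω)) / Fintype.card Ω := by
  simp only [uniformImage, mul_div_assoc', Finset.mul_sum]
  rw [← Finset.sum_div, Finset.sum_comm]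
  simp

lemma sum_uniformImage {Ω α : Type*} [Fintype Ω] [Nonempty Ω] [Fintype α] (φ : Ω → α) :
    ∑ a, uniformImage φ a = 1 := by
  have := sum_mul_uniformImage φ (fun _ => 1)
  simpa using this

lemma uniformImage_eq_zero {Ω α : Type*} [Fintype Ω] {φ : Ω → α} {a : α} (h : ∀ ω, φ ω ≠ a) :
    uniformImage φ a = 0 := by
  simp [uniformImage, h]

/-- Disjoint pair of subsets of `T` and of its complement, for `s = (T, z, w)`. -/
def disjointPair {ι : Type*} (s : (ι → Bool) × (ι → Bool) × (ι → Bool)) :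
    (ι → Bool) × (ι → Bool) :=
  (s.2.1 ⊓ s.1, s.2.2 ⊓ s.1ᶜ)

/-- The pair `disjointPair` with a common element `i` inserted. -/
def crossingPair {ι : Type*} [DecidableEq ι]
    (s : ι × (ι → Bool) × (ι → Bool) × (ι → Bool)) :
    (ι → Bool) × (ι → Bool) :=
  (Function.update (disjointPair s.2).1 s.1 true, Function.update (disjointPair s.2).2 s.1 true)

lemma DISJ_disjointPair {n : ℕ} (s) :
    DISJ (disjointPair (ι := Fin n) s).1 (disjointPair s).2 = true := by
  refine decide_eq_true ?_
  rintro i ⟨h1, h2⟩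
  simp only [disjointPair, Pi.inf_apply, Pi.compl_apply] at h1 h2
  cases h : s.1 i <;> simp [h] at h1 h2

lemma DISJ_crossingPair {n : ℕ} (s) :
    DISJ (crossingPair (ι := Fin n) s).1 (crossingPair s).2 = false := by
  refine decide_eq_false fun h => h s.1 ?_
  simp [crossingPair]

/-- Corruption bound for disjointness: rectangles that are not tiny have, up to a constant, at
least as much mass on crossing pairs as on disjoint pairs. -/
lemma disjointPair_le_crossingPair {ι : Type*} [Fintype ι] [DecidableEq ι] [Nonempty ι]
    {f g : (ι → Bool) → ℝ} (hf0 : ∀ z, 0 ≤ f z) (hf1 : ∀ z, f z ≤ 1)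
    (hg0 : ∀ z, 0 ≤ g z) (hg1 : ∀ z, g z ≤ 1) :
    ∑ c, f c.1 * g c.2 * uniformImage (disjointPair (ι := ι)) c
      ≤ 36 * ∑ c, f c.1 * g c.2 * uniformImage (crossingPair (ι := ι)) c
        + 20 * Real.exp (-(Fintype.card ι / 200)) := by
  rw [sum_mul_uniformImage _ (fun c : (ι → Bool) × (ι → Bool) => f c.1 * g c.2),
    sum_mul_uniformImage _ (fun c : (ι → Bool) × (ι → Bool) => f c.1 * g c.2)]
  have hD : ∑ s, f (disjointPair (ι := ι) s).1 * g (disjointPair s).2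
      = ∑ T, subcubeSum f T * subcubeSum g Tᶜ := by
    rw [Fintype.sum_prod_type]
    refine Finset.sum_congr rfl fun T _ => ?_
    rw [Fintype.sum_prod_type, subcubeSum, subcubeSum, Finset.sum_mul_sum]
    rfl
  have hC : ∑ s, f (crossingPair (ι := ι) s).1 * g (crossingPair s).2
      = ∑ i, ∑ T, fixedSum f T i true * fixedSum g Tᶜ i true := by
    rw [Fintype.sum_prod_type]
    refine Finset.sum_congr rfl fun i _ => ?_
    rw [Fintype.sum_prod_type]
    refine Finset.sum_congr rfl fun T _ => ?_
    rw [Fintype.sum_prod_type, fixedSum, fixedSum, Finset.sum_mul_sum]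
    rfl
  have h8 : (8 : ℝ) ^ Fintype.card ι
      = 2 ^ Fintype.card ι * (2 ^ Fintype.card ι * 2 ^ Fintype.card ι) := by
    rw [← mul_pow, ← mul_pow]; norm_num
  have hcard : (Fintype.card ((ι → Bool) × (ι → Bool) × (ι → Bool)) : ℝ)
      = 8 ^ Fintype.card ι := by
    rw [h8]; simp
  have hcard' : (Fintype.card (ι × (ι → Bool) × (ι → Bool) × (ι → Bool)) : ℝ)
      = Fintype.card ι * 8 ^ Fintype.card ι := by
    rw [h8]; simp
  rw [hD, hC, hcard, hcard', div_le_iff₀ (by positivity), ← div_div]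
  refine (corruption_bound hf0 hf1 hg0 hg1).trans_eq ?_
  field_simp

/-- The balanced hard distribution for disjointness. -/
noncomputable def hardDist (n : ℕ) (c : (Fin n → Bool) × (Fin n → Bool)) : ℝ :=
  (uniformImage (disjointPair (ι := Fin n)) c + uniformImage (crossingPair (ι := Fin n)) c) / 2

/-- A measure of total mass below one dominating, on rectangles, either half of `hardDist`. -/
noncomputable def dominatingWeight (n : ℕ) (c : (Fin n → Bool) × (Fin n → Bool)) : ℝ :=
  (35 / 36 * uniformImage (disjointPair (ι := Fin n)) c
    + uniformImage (crossingPair (ι := Fin n)) c) / 2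

/-- `hardDist` restricted to the pairs on which disjointness evaluates to `b`. -/
noncomputable def hardDistOn (n : ℕ) (b : Bool) (c : (Fin n → Bool) × (Fin n → Bool)) : ℝ :=
  if DISJ c.1 c.2 = b then hardDist n c else 0

lemma hardDist_nonneg {n : ℕ} (c) : 0 ≤ hardDist n c :=
  div_nonneg (add_nonneg (uniformImage_nonneg _ _) (uniformImage_nonneg _ _)) zero_le_two

lemma dominatingWeight_nonneg {n : ℕ} (c) : 0 ≤ dominatingWeight n c :=
  div_nonneg (add_nonneg (mul_nonneg (by norm_num) (uniformImage_nonneg _ _))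
    (uniformImage_nonneg _ _)) zero_le_two

lemma hardDistOn_true {n : ℕ} (c) :
    hardDistOn n true c = uniformImage (disjointPair (ι := Fin n)) c / 2 := by
  rw [hardDistOn]
  split_ifs with h
  · rw [hardDist, uniformImage_eq_zero (φ := crossingPair), add_zero]
    rintro s rfl
    simp [DISJ_crossingPair] at h
  · rw [uniformImage_eq_zero, zero_div]
    rintro s rfl
    exact h (DISJ_disjointPair s)

lemma hardDistOn_false {n : ℕ} (c) :
    hardDistOn n false c = uniformImage (crossingPair (ι := Fin n)) c / 2 := by
  rw [hardDistOn]
  split_ifs with h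
  · rw [hardDist, uniformImage_eq_zero (φ := disjointPair), zero_add]
    rintro s rfl
    simp [DISJ_disjointPair] at h
  · rw [uniformImage_eq_zero, zero_div]
    rintro s rfl
    exact h (DISJ_crossingPair s)

lemma sum_hardDistOn {n : ℕ} [NeZero n] (b : Bool) : ∑ c, hardDistOn n b c = 1 / 2 := by
  cases b
  · simp_rw [hardDistOn_false]
    rw [← Finset.sum_div, sum_uniformImage]
  · simp_rw [hardDistOn_true]
    rw [← Finset.sum_div, sum_uniformImage]

lemma sum_hardDist {n : ℕ} [NeZero n] : ∑ c, hardDist n c = 1 := by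
  simp_rw [hardDist]
  rw [← Finset.sum_div, Finset.sum_add_distrib, sum_uniformImage, sum_uniformImage]
  norm_num

lemma sum_dominatingWeight {n : ℕ} [NeZero n] : ∑ c, dominatingWeight n c = 71 / 72 := by
  simp_rw [dominatingWeight]
  rw [← Finset.sum_div, Finset.sum_add_distrib, ← Finset.mul_sum, sum_uniformImage,
    sum_uniformImage]
  norm_num

lemma hardDistOn_le_dominatingWeight {n : ℕ} [NeZero n] (b : Bool) {f g : (Fin n → Bool) → ℝ}
    (hf0 : ∀ z, 0 ≤ f z) (hf1 : ∀ z, f z ≤ 1) (hg0 : ∀ z, 0 ≤ g z) (hg1 : ∀ z, g z ≤ 1) :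
    ∑ c, f c.1 * g c.2 * hardDistOn n b c
      ≤ ∑ c, f c.1 * g c.2 * dominatingWeight n c + Real.exp (-(n / 200)) := by
  have hcor := disjointPair_le_crossingPair hf0 hf1 hg0 hg1
  rw [Fintype.card_fin] at hcor
  have hexp := Real.exp_pos (-(n / 200 : ℝ))
  have hD0 : 0 ≤ ∑ c, f c.1 * g c.2 * uniformImage (disjointPair (ι := Fin n)) c :=
    Finset.sum_nonneg fun c _ =>
      mul_nonneg (mul_nonneg (hf0 _) (hg0 _)) (uniformImage_nonneg _ _)
  have hρ : ∑ c, f c.1 * g c.2 * dominatingWeight n c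
      = 35 / 72 * (∑ c, f c.1 * g c.2 * uniformImage (disjointPair (ι := Fin n)) c)
        + 1 / 2 * ∑ c, f c.1 * g c.2 * uniformImage (crossingPair (ι := Fin n)) c := by
    rw [Finset.mul_sum, Finset.mul_sum, ← Finset.sum_add_distrib]
    refine Finset.sum_congr rfl fun c _ => ?_
    rw [dominatingWeight]
    ring
  rw [hρ]
  cases b
  · simp_rw [hardDistOn_false, mul_div_assoc']
    rw [← Finset.sum_div]
    linarith
  · simp_rw [hardDistOn_true, mul_div_assoc']
    rw [← Finset.sum_div]
    linarith

/-- The mass of correctly labelled inputs in a rectangle, as a sum over lists of pairs. -/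
lemma sum_correct_eq {n k : ℕ} (A B : Finset (Fin k → (Fin n → Bool))) (L : Fin k → Bool) :
    ∑ p ∈ (A ×ˢ B).filter (fun p => ∀ t, DISJ (p.1 t) (p.2 t) = L t),
        ∏ t, hardDist n (p.1 t, p.2 t)
      = ∑ q : Fin k → (Fin n → Bool) × (Fin n → Bool),
          (if (fun t => (q t).1) ∈ A then (1 : ℝ) else 0)
            * (if (fun t => (q t).2) ∈ B then (1 : ℝ) else 0) * ∏ t, hardDistOn n (L t) (q t) := by
  have hprod : ∀ q : Fin k → (Fin n → Bool) × (Fin n → Bool), ∏ t, hardDistOn n (L t) (q t)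
      = if ∀ t, DISJ (q t).1 (q t).2 = L t then ∏ t, hardDist n (q t) else 0 := by
    intro q
    split_ifs with h
    · exact Finset.prod_congr rfl fun t _ => by rw [hardDistOn, if_pos (h t)]
    · push Not at h
      obtain ⟨t, ht⟩ := h
      exact Finset.prod_eq_zero (Finset.mem_univ t) (by rw [hardDistOn, if_neg ht])
  simp_rw [hprod]
  rw [← Finset.univ_inter (A ×ˢ B), ← Finset.filter_mem_eq_inter, Finset.filter_filter,
    Finset.sum_filter, ← Equiv.sum_comp (Equiv.arrowProdEquivProdArrow (Fin k)
      (fun _ => Fin n → Bool) (fun _ => Fin n → Bool))]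
  refine Finset.sum_congr rfl fun q _ => ?_
  simp only [Equiv.arrowProdEquivProdArrow, Equiv.coe_fn_mk, Finset.mem_product]
  by_cases hA : (fun t => (q t).1) ∈ A <;> by_cases hB : (fun t => (q t).2) ∈ B <;>
    simp [hA, hB]

lemma sum_disjoint_rectangles_le {X Y : Type*} [DecidableEq X] [DecidableEq Y] {N : ℕ}
    (A : Fin N → Finset X) (B : Fin N → Finset Y)
    (hdisj : ∀ i j, i ≠ j → Disjoint (A i ×ˢ B i) (A j ×ˢ B j)) (x : X) (y : Y) :
    ∑ i, (if x ∈ A i then (1 : ℝ) else 0) * (if y ∈ B i then (1 : ℝ) else 0) ≤ 1 := by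
  have h : ∀ i, (if x ∈ A i then (1 : ℝ) else 0) * (if y ∈ B i then (1 : ℝ) else 0)
      = if (x, y) ∈ A i ×ˢ B i then 1 else 0 := by
    intro i
    by_cases hx : x ∈ A i <;> by_cases hy : y ∈ B i <;> simp [hx, hy]
  simp_rw [h]
  rw [Finset.sum_boole]
  have : (Finset.univ.filter fun i => (x, y) ∈ A i ×ˢ B i).card ≤ 1 := by
    refine Finset.card_le_one.mpr fun i hi j hj => ?_
    by_contra hij
    exact Finset.disjoint_left.mp (hdisj i j hij) (Finset.mem_filter.mp hi).2
      (Finset.mem_filter.mp hj).2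
  exact_mod_cast this

lemma sum_correct_rectangle_le {n k : ℕ} [NeZero n] (A B : Finset (Fin k → (Fin n → Bool)))
    (L : Fin k → Bool) :
    ∑ p ∈ (A ×ˢ B).filter (fun p => ∀ t, DISJ (p.1 t) (p.2 t) = L t),
        ∏ t, hardDist n (p.1 t, p.2 t)
      ≤ ∑ q : Fin k → (Fin n → Bool) × (Fin n → Bool),
          (if (fun t => (q t).1) ∈ A then (1 : ℝ) else 0)
            * (if (fun t => (q t).2) ∈ B then (1 : ℝ) else 0) * ∏ t, dominatingWeight n (q t)
          + k * Real.exp (-(n / 200)) := by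
  have hnonneg : ∀ t c, 0 ≤ hardDistOn n (L t) c := by
    intro t c
    rw [hardDistOn]
    split_ifs
    · exact hardDist_nonneg c
    · exact le_rfl
  have hmass : ∀ t, ∑ c, hardDistOn n (L t) c ≤ 1 := by
    intro t
    rw [sum_hardDistOn]
    norm_num
  have h0 : ∀ (S : Finset (Fin k → (Fin n → Bool))) x, (0 : ℝ) ≤ if x ∈ S then 1 else 0 := by
    intro S x
    split_ifs <;> norm_num
  have h1 : ∀ (S : Finset (Fin k → (Fin n → Bool))) x, (if x ∈ S then (1 : ℝ) else 0) ≤ 1 := by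
    intro S x
    split_ifs <;> norm_num
  have hρ1 : ∑ c, dominatingWeight n c ≤ 1 := by
    rw [sum_dominatingWeight]
    norm_num
  rw [sum_correct_eq]
  exact sum_rectangle_prod_le (dominatingWeight n) _ dominatingWeight_nonneg hρ1
    (Real.exp_pos _).le k (fun t => hardDistOn n (L t)) hnonneg hmass
    (fun t _ _ => hardDistOn_le_dominatingWeight (L t)) (fun x => if x ∈ A then (1 : ℝ) else 0)
    (fun y => if y ∈ B then (1 : ℝ) else 0) (h0 A) (h1 A) (h0 B) (h1 B)

lemma sum_correct_le {n k N : ℕ} [NeZero n] (A B : Fin N → Finset (Fin k → (Fin n → Bool)))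
    (L : Fin N → Fin k → Bool)
    (hdisj : ∀ i j, i ≠ j → Disjoint (A i ×ˢ B i) (A j ×ˢ B j)) :
    ∑ i, ∑ p ∈ (A i ×ˢ B i).filter (fun p => ∀ t, DISJ (p.1 t) (p.2 t) = L i t),
        ∏ t, hardDist n (p.1 t, p.2 t)
      ≤ (71 / 72) ^ k + N * (k * Real.exp (-(n / 200))) := by
  refine (Finset.sum_le_sum fun i _ => sum_correct_rectangle_le (A i) (B i) (L i)).trans ?_
  rw [Finset.sum_add_distrib, Finset.sum_const, Finset.card_univ, Fintype.card_fin, nsmul_eq_mul,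
    Finset.sum_comm]
  refine add_le_add_left ?_ _
  rw [← sum_dominatingWeight (n := n), Fintype.sum_pow]
  refine Finset.sum_le_sum fun q _ => ?_
  rw [← Finset.sum_mul]
  exact mul_le_of_le_one_left (Finset.prod_nonneg fun t _ => dominatingWeight_nonneg _)
    (sum_disjoint_rectangles_le A B hdisj _ _)

lemma error_bound {n k N : ℕ} (hk : 0 < k) (hkn : (k : ℝ) ≤ 1 / 2000 * n)
    (hN : (N : ℝ) ≤ (2 : ℝ) ^ (1 / 2000 * n : ℝ)) :
    (71 / 72 : ℝ) ^ k + N * (k * Real.exp (-(n / 200))) ≤ (2 : ℝ) ^ (-(1 / 200 * k : ℝ)) := by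
  have h2 : (2 : ℝ) ≤ Real.exp 1 := by
    have := Real.exp_one_gt_d9
    linarith
  have hN' : (N : ℝ) ≤ Real.exp (1 / 2000 * n) := by
    refine hN.trans ?_
    rw [← Real.exp_one_rpow]
    gcongr
  have hk' : (k : ℝ) ≤ Real.exp k := by
    have := Real.add_one_le_exp (k : ℝ)
    linarith
  have h8 : Real.exp (-8) ≤ 1 / 256 := by
    have : (256 : ℝ) ≤ Real.exp 8 := by
      have h := pow_le_pow_left₀ (by norm_num) h2 8
      rw [← Real.exp_nat_mul] at h
      norm_num at h
      exact h
    rw [Real.exp_neg, one_div]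
    gcongr
  have herr : N * (k * Real.exp (-(n / 200))) ≤ Real.exp (-8) ^ k := by
    calc N * (k * Real.exp (-(n / 200)))
        ≤ Real.exp (1 / 2000 * n) * (Real.exp k * Real.exp (-(n / 200))) := by gcongr
      _ = Real.exp (1 / 2000 * n + (k + -(n / 200))) := by rw [Real.exp_add, Real.exp_add]
      _ ≤ Real.exp (k * -8) := by
          rw [Real.exp_le_exp]
          linarith
      _ = _ := Real.exp_nat_mul _ _
  calc (71 / 72 : ℝ) ^ k + N * (k * Real.exp (-(n / 200)))
      ≤ (71 / 72) ^ k + Real.exp (-8) ^ k := by gcongr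
    _ ≤ (71 / 72 + Real.exp (-8)) ^ k :=
        pow_add_pow_le (by norm_num) (Real.exp_pos _).le hk.ne'
    _ ≤ Real.exp (-(1 / 200)) ^ k := by
        have := Real.add_one_le_exp (-(1 / 200) : ℝ)
        gcongr
        linarith
    _ = (Real.exp (1 / 200 * k))⁻¹ := by
        rw [← Real.exp_nat_mul, ← Real.exp_neg]
        congr 1
        ring
    _ ≤ (2 : ℝ) ^ (-(1 / 200 * k : ℝ)) := by
        rw [Real.rpow_neg (by norm_num)]
        gcongr
        rw [← Real.exp_one_rpow (1 / 200 * (k : ℝ))]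
        gcongr

theorem stmt5 :
    ∃ ε γ : ℝ, 0 < ε ∧ 0 < γ ∧
      ∀ n : ℕ, 0 < n →
        ∃ ν : (Fin n → Bool) × (Fin n → Bool) → ℝ,
          (∀ p, 0 ≤ ν p) ∧ (∑ p, ν p = 1) ∧
          -- ν is balanced for DISJ
          (∑ p ∈ Finset.univ.filter (fun p => DISJ p.1 p.2 = true), ν p = 1 / 2) ∧
          (∑ p ∈ Finset.univ.filter (fun p => DISJ p.1 p.2 = false), ν p = 1 / 2) ∧
          ∀ (k : ℕ), 0 < k → (k : ℝ) ≤ ε * n →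
            ∀ (N : ℕ) (A : Fin N → Finset (Fin k → (Fin n → Bool)))
              (B : Fin N → Finset (Fin k → (Fin n → Bool)))
              (L : Fin N → (Fin k → Bool)),
              (N : ℝ) ≤ (2 : ℝ) ^ (ε * n) →
              -- the labeled rectangles are pairwise disjoint and cover everything
              (∀ i j, i ≠ j → Disjoint (A i ×ˢ B i) (A j ×ˢ B j)) →
              (∀ p : (Fin k → (Fin n → Bool)) × (Fin k → (Fin n → Bool)),
                ∃ i, p ∈ A i ×ˢ B i) →
              -- the ν^k-probability that the label is correct is at most 2^{-γk}
              ∑ i, ∑ p ∈ (A i ×ˢ B i).filter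
                    (fun p => ∀ t, DISJ (p.1 t) (p.2 t) = L i t),
                  ∏ t, ν (p.1 t, p.2 t)
                ≤ (2 : ℝ) ^ (-(γ * k)) := by
  refine ⟨1 / 2000, 1 / 200, by norm_num, by norm_num, fun n hn => ?_⟩
  have : NeZero n := ⟨hn.ne'⟩
  refine ⟨hardDist n, hardDist_nonneg, sum_hardDist, ?_, ?_, ?_⟩
  · rw [Finset.sum_filter]
    exact sum_hardDistOn true
  · rw [Finset.sum_filter]
    exact sum_hardDistOn false
  · intro k hk hkn N A B L hN hdisj _
    exact (sum_correct_le A B L hdisj).trans (error_bound hk hkn hN)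
end

section
/- Let (h_i)_{i ∈ I} be a pairwise universal family of hash functions from a finite nonempty set X to Z = {0,…,m−1}, indexed by a finite nonempty set I. Let t and k be positive integers with 4^t ≤ m, and let S ⊆ {0,…,t−1} with |S| = k. Define g : X × I → {0,1}^S by letting g(x, i) be the tuple of binary digits of h_i(x) at the positions in S. Then mdisc(g) ≤ |X|^{-1/4} + 2/√m. -/
open scoped Classical

/-- `mdiscLE f ε` says that the multicolor discrepancy of `f : X × Y → Z`
(w.r.t. the uniform distribution on `X × Y`) is at most `ε`. -/
def mdiscLE {X Y Z : Type*} [Fintype X] [Fintype Y] [Fintype Z]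
    (f : X × Y → Z) (ε : ℝ) : Prop :=
  ∀ (A : Finset X) (B : Finset Y) (z : Z),
    |(((A ×ˢ B).filter (fun p => f p = z)).card : ℝ) /
        ((Fintype.card X : ℝ) * (Fintype.card Y : ℝ)) -
      ((A.card : ℝ) * (B.card : ℝ)) /
        ((Fintype.card X : ℝ) * (Fintype.card Y : ℝ) * (Fintype.card Z : ℝ))| ≤ ε

/-- `(h i)_{i ∈ I}` is a pairwise universal family of hash functions from `X` to `Z`. -/
def PairwiseUniversal {I X Z : Type*} [Fintype I] [Fintype Z]
    (h : I → X → Z) : Prop :=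
  (∀ (x : X) (z : Z),
    (Finset.univ.filter (fun i => h i x = z)).card * Fintype.card Z = Fintype.card I) ∧
  (∀ (x x' : X), x ≠ x' → ∀ (z z' : Z),
    (Finset.univ.filter (fun i => h i x = z ∧ h i x' = z')).card * Fintype.card I =
      (Finset.univ.filter (fun i => h i x = z)).card *
        (Finset.univ.filter (fun i => h i x' = z')).card)

open Finset in
/-- Averaging a function of one hash value. -/
theorem PairwiseUniversal.sum_apply {I X Z : Type*} [Fintype I] [Fintype Z]
    {h : I → X → Z} (hh : PairwiseUniversal h) (x : X) (φ : Z → ℝ) :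
    (∑ i, φ (h i x)) * Fintype.card Z = Fintype.card I * ∑ z, φ z := by
  rw [← Finset.sum_fiberwise univ (fun i => h i x), sum_mul, mul_sum]
  refine sum_congr rfl fun z _ => ?_
  have hz : ∑ i with h i x = z, φ (h i x) = #{i | h i x = z} * φ z := by
    rw [← nsmul_eq_mul]
    exact sum_eq_card_nsmul fun i hi => by rw [(mem_filter.1 hi).2]
  have hc : (#{i | h i x = z} : ℝ) * Fintype.card Z = Fintype.card I := by
    exact_mod_cast hh.1 x z
  rw [hz, ← hc]
  ring

open Finset in
/-- A function of mean zero, evaluated at the hash values of two distinct points, is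
uncorrelated. -/
theorem PairwiseUniversal.sum_mul_eq_zero {I X Z : Type*} [Fintype I] [Nonempty I] [Fintype Z]
    {h : I → X → Z} (hh : PairwiseUniversal h) {x x' : X} (hx : x ≠ x') {φ : Z → ℝ}
    (hφ : ∑ z, φ z = 0) : ∑ i, φ (h i x) * φ (h i x') = 0 := by
  have hI : (Fintype.card I : ℝ) ≠ 0 := by exact_mod_cast Fintype.card_ne_zero
  refine (mul_eq_zero.1 ?_).resolve_right hI
  have hone (y : X) : ∑ z, (#{i | h i y = z} : ℝ) * φ z = ∑ i, φ (h i y) := by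
    rw [← Finset.sum_fiberwise univ (fun i => h i y) (fun i => φ (h i y))]
    refine sum_congr rfl fun z _ => ?_
    rw [← nsmul_eq_mul]
    exact (sum_eq_card_nsmul fun i hi => by rw [(mem_filter.1 hi).2]).symm
  have hcard : (Fintype.card Z : ℝ) ≠ 0 := by
    have : Nonempty Z := ‹Nonempty I›.map fun i => h i x
    exact_mod_cast Fintype.card_ne_zero
  have hzero : ∑ i, φ (h i x) = 0 :=
    (mul_eq_zero.1 (by rw [hh.sum_apply, hφ, mul_zero])).resolve_right hcard
  calc (∑ i, φ (h i x) * φ (h i x')) * Fintype.card I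
      = ∑ q : Z × Z, (#{i | h i x = q.1} * φ q.1) * (#{i | h i x' = q.2} * φ q.2) := by
        rw [← Finset.sum_fiberwise univ (fun i => (h i x, h i x')), sum_mul]
        refine sum_congr rfl fun q _ => ?_
        have hz : ∑ i with (h i x, h i x') = q, φ (h i x) * φ (h i x') =
            #{i | h i x = q.1 ∧ h i x' = q.2} * (φ q.1 * φ q.2) := by
          rw [← nsmul_eq_mul]
          simp only [Prod.ext_iff]
          exact sum_eq_card_nsmul fun i hi => by
            rw [(mem_filter.1 hi).2.1, (mem_filter.1 hi).2.2]
        have hc : (#{i | h i x = q.1 ∧ h i x' = q.2} : ℝ) * Fintype.card I =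
            #{i | h i x = q.1} * #{i | h i x' = q.2} := by
          exact_mod_cast hh.2 x x' hx q.1 q.2
        rw [hz]
        linear_combination φ q.1 * φ q.2 * hc
    _ = (∑ z, #{i | h i x = z} * φ z) * ∑ z, #{i | h i x' = z} * φ z := by
        rw [Fintype.sum_prod_type, sum_mul_sum]
    _ = 0 := by rw [hone, hzero, zero_mul]

open Finset in
/-- Second moment bound for a mean-zero function of the hash values over a rectangle. -/
theorem PairwiseUniversal.abs_sum_le {I X Z : Type*} [Fintype I] [Nonempty I] [Fintype X]
    [Fintype Z] {h : I → X → Z} (hh : PairwiseUniversal h) {φ : Z → ℝ} (hφ : ∑ z, φ z = 0)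
    (hle : ∀ z, |φ z| ≤ 1) (A : Finset X) (B : Finset I) :
    |∑ i ∈ B, ∑ x ∈ A, φ (h i x)| ≤ Fintype.card I * √(Fintype.card X) := by
  have hB : (#B : ℝ) ≤ Fintype.card I := by exact_mod_cast card_le_univ B
  have hA : (#A : ℝ) ≤ Fintype.card X := by exact_mod_cast card_le_univ A
  have hmoment : ∑ i, (∑ x ∈ A, φ (h i x)) ^ 2 ≤ #A * Fintype.card I := by
    calc ∑ i, (∑ x ∈ A, φ (h i x)) ^ 2
        = ∑ x ∈ A, ∑ x' ∈ A, ∑ i, φ (h i x) * φ (h i x') := by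
          simp_rw [sq, sum_mul_sum]
          rw [sum_comm]
          exact sum_congr rfl fun x _ => sum_comm
      _ = ∑ x ∈ A, ∑ i, φ (h i x) * φ (h i x) := by
          refine sum_congr rfl fun x hx => ?_
          exact sum_eq_single_of_mem x hx fun x' _ hne => hh.sum_mul_eq_zero hne.symm hφ
      _ ≤ ∑ x ∈ A, ∑ _i : I, (1 : ℝ) := by
          refine sum_le_sum fun x _ => sum_le_sum fun i _ => ?_
          rw [← sq]
          exact (sq_le_one_iff_abs_le_one _).2 (hle _)
      _ = #A * Fintype.card I := by simp
  refine abs_le_of_sq_le_sq ?_ (by positivity)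
  rw [mul_pow, Real.sq_sqrt (by positivity)]
  calc (∑ i ∈ B, ∑ x ∈ A, φ (h i x)) ^ 2
      ≤ #B * ∑ i ∈ B, (∑ x ∈ A, φ (h i x)) ^ 2 := sq_sum_le_card_mul_sum_sq
    _ ≤ Fintype.card I * ∑ i, (∑ x ∈ A, φ (h i x)) ^ 2 := by
        gcongr
        exact subset_univ B
    _ ≤ Fintype.card I * (#A * Fintype.card I) := by gcongr
    _ ≤ Fintype.card I * (Fintype.card X * Fintype.card I) := by gcongr
    _ = Fintype.card I ^ 2 * Fintype.card X := by ring

/-- Prescribing the binary digits in `S` selects a `2 ^ #S` fraction of the numbers below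
`2 ^ t`. -/
theorem Nat.count_testBit_eq_mul (c : ℕ → Bool) (t : ℕ) :
    ∀ S ⊆ Finset.range t,
      Nat.count (fun n => ∀ s ∈ S, n.testBit s = c s) (2 ^ t) * 2 ^ S.card = 2 ^ t := by
  induction t with
  | zero =>
    intro S hS
    obtain rfl : S = ∅ := by simpa using hS
    simp
  | succ t ih =>
    intro S hS
    have hlow {a s : ℕ} (hs : s < t) : (2 ^ t + a).testBit s = a.testBit s :=
      Nat.testBit_two_pow_add_gt hs a
    have hErase : S.erase t ⊆ Finset.range t := fun s hs => by
      have h1 := Finset.mem_range.1 (hS (Finset.mem_of_mem_erase hs))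
      have h2 := Finset.ne_of_mem_erase hs
      exact Finset.mem_range.2 (by omega)
    have ih' := ih _ hErase
    rw [pow_succ, mul_two, Nat.count_add]
    by_cases htS : t ∈ S
    · have hsplit (n : ℕ) : (∀ s ∈ S, n.testBit s = c s) ↔
          n.testBit t = c t ∧ ∀ s ∈ S.erase t, n.testBit s = c s := by
        conv_lhs => rw [← Finset.insert_erase htS]
        exact Finset.forall_mem_insert _ _ _
      have hcard := Finset.card_erase_add_one htS
      have hfst : Nat.count (fun n => ∀ s ∈ S, n.testBit s = c s) (2 ^ t) =
          if c t then 0 else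
            Nat.count (fun n => ∀ s ∈ S.erase t, n.testBit s = c s) (2 ^ t) := by
        simp only [Nat.count_eq_card_filter_range]
        split_ifs with hc
        · refine Finset.card_eq_zero.2 (Finset.filter_eq_empty_iff.2 fun n hn => ?_)
          rw [hsplit, hc, Nat.testBit_lt_two_pow (Finset.mem_range.1 hn)]
          simp
        · congr 1
          refine Finset.filter_congr fun n hn => ?_
          rw [hsplit, Nat.testBit_lt_two_pow (Finset.mem_range.1 hn)]
          simp [hc]
      have hsnd : Nat.count (fun n => ∀ s ∈ S, (2 ^ t + n).testBit s = c s) (2 ^ t) =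
          if c t then
            Nat.count (fun n => ∀ s ∈ S.erase t, n.testBit s = c s) (2 ^ t) else 0 := by
        simp only [Nat.count_eq_card_filter_range]
        split_ifs with hc
        · congr 1
          refine Finset.filter_congr fun n hn => ?_
          rw [hsplit, Nat.testBit_two_pow_add_eq,
            Nat.testBit_lt_two_pow (Finset.mem_range.1 hn), hc]
          simp only [Bool.not_false, true_and]
          exact forall₂_congr fun s hs => by rw [hlow (Finset.mem_range.1 (hErase hs))]
        · refine Finset.card_eq_zero.2 (Finset.filter_eq_empty_iff.2 fun n hn => ?_)
          rw [hsplit, Nat.testBit_two_pow_add_eq,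
            Nat.testBit_lt_two_pow (Finset.mem_range.1 hn)]
          simp [hc]
      rw [hfst, hsnd, ← hcard, pow_succ]
      split_ifs <;> linarith
    · rw [Finset.erase_eq_of_notMem htS] at ih' hErase
      have hsnd : Nat.count (fun n => ∀ s ∈ S, (2 ^ t + n).testBit s = c s) (2 ^ t) =
          Nat.count (fun n => ∀ s ∈ S, n.testBit s = c s) (2 ^ t) := by
        congr! 5 with n s hs
        rw [hlow (Finset.mem_range.1 (hErase hs))]
      rw [hsnd, add_mul, ih']

/-- Up to an error of `2 ^ t`, the share of numbers below `m` with prescribed binary digits in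
`S ⊆ {0, …, t - 1}` is `2 ^ (-#S)`. -/
theorem Nat.abs_count_testBit_sub_le (c : ℕ → Bool) {t : ℕ} {S : Finset ℕ}
    (hS : S ⊆ Finset.range t) (m : ℕ) :
    |(Nat.count (fun n => ∀ s ∈ S, n.testBit s = c s) m : ℝ) * 2 ^ S.card - m| ≤ 2 ^ t := by
  set p : ℕ → Prop := fun n => ∀ s ∈ S, n.testBit s = c s with hp
  have hT : Nat.count p (2 ^ t) * 2 ^ S.card = 2 ^ t := Nat.count_testBit_eq_mul c t S hS
  have hperiod (q a : ℕ) : p (2 ^ t * q + a) ↔ p a := by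
    refine forall₂_congr fun s hs => ?_
    have hst := Finset.mem_range.1 (hS hs)
    have hmod := congrArg (Nat.testBit · s) (Nat.mul_add_mod (2 ^ t) q a)
    simp only [Nat.testBit_mod_two_pow, hst, decide_true, Bool.true_and] at hmod
    rw [hmod]
  have hcount (q : ℕ) : Nat.count p (2 ^ t * q) = q * Nat.count p (2 ^ t) := by
    induction q with
    | zero => simp
    | succ q ih =>
      rw [mul_add_one, Nat.count_add, ih, add_one_mul]
      simp_rw [hperiod]
  have hm : Nat.count p m = m / 2 ^ t * Nat.count p (2 ^ t) + Nat.count p (m % 2 ^ t) := by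
    conv_lhs => rw [← Nat.div_add_mod m (2 ^ t), Nat.count_add, hcount]
    simp_rw [hperiod]
  have hr : m % 2 ^ t < 2 ^ t := Nat.mod_lt _ (by positivity)
  have hle : Nat.count p (m % 2 ^ t) * 2 ^ S.card ≤ 2 ^ t :=
    (Nat.mul_le_mul_right _ (Nat.count_monotone p hr.le)).trans_eq hT
  have hmul : Nat.count p m * 2 ^ S.card + m % 2 ^ t =
      m + Nat.count p (m % 2 ^ t) * 2 ^ S.card := by
    rw [hm, add_mul, mul_assoc, hT]
    have := Nat.div_add_mod' m (2 ^ t)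
    omega
  have hmul' : (Nat.count p m : ℝ) * 2 ^ S.card + (m % 2 ^ t : ℕ) =
      m + Nat.count p (m % 2 ^ t) * 2 ^ S.card := by exact_mod_cast hmul
  have hr' : ((m % 2 ^ t : ℕ) : ℝ) < 2 ^ t := by exact_mod_cast hr
  have hle' : (Nat.count p (m % 2 ^ t) : ℝ) * 2 ^ S.card ≤ 2 ^ t := by exact_mod_cast hle
  have h0 : (0 : ℝ) ≤ (m % 2 ^ t : ℕ) := by positivity
  have h1 : (0 : ℝ) ≤ Nat.count p (m % 2 ^ t) * 2 ^ S.card := by positivity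
  rw [abs_le]
  constructor <;> linarith

theorem stmt10 (I X : Type) [Fintype I] [Fintype X] [Nonempty I] [Nonempty X]
    (m : ℕ) (hm : 0 < m)
    (h : I → X → Fin m) (huniv : PairwiseUniversal h)
    (t k : ℕ) (ht : 0 < t) (hk : 0 < k) (h4 : 4 ^ t ≤ m)
    (S : Finset ℕ) (hS : S ⊆ Finset.range t) (hScard : S.card = k) :
    mdiscLE
      (fun q : X × I => fun s : {a // a ∈ S} => ((h q.2 q.1 : ℕ)).testBit s.1)
      ((Fintype.card X : ℝ) ^ (-(1 : ℝ) / 4) + 2 / Real.sqrt m) := by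
  intro A B z
  set c : ℕ → Bool := fun s => if hs : s ∈ S then z ⟨s, hs⟩ else false with hc
  set p : ℕ → Prop := fun n => ∀ s ∈ S, n.testBit s = c s with hp
  set P : ℝ := ((Nat.count p m : ℕ) : ℝ) with hP
  set N : ℝ := (Fintype.card X : ℝ) with hN
  set M : ℝ := (Fintype.card I : ℝ) with hM
  have hm0 : (0 : ℝ) < m := by exact_mod_cast hm
  have hN0 : 1 ≤ N := Nat.one_le_cast.2 Fintype.card_pos
  have hM0 : 0 < M := Nat.cast_pos.2 Fintype.card_pos
  have hcolor (n : ℕ) : (fun s : {a // a ∈ S} => n.testBit s.1) = z ↔ p n := by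
    rw [funext_iff, Subtype.forall]
    exact forall₂_congr fun s hs => by simp [hc, hs]
  set φ : Fin m → ℝ := fun n => (if p n then 1 else 0) - P / m with hφ
  have hPm : P ≤ m := Nat.cast_le.2 (Nat.count_le p)
  have hP0 : 0 ≤ P := by positivity
  have hsum : ∑ n, φ n = 0 := by
    have hind : ∑ n : Fin m, (if p n then (1 : ℝ) else 0) = P := by
      rw [Fin.sum_univ_eq_sum_range (fun n => if p n then (1 : ℝ) else 0), Finset.sum_boole,
        hP, Nat.count_eq_card_filter_range]
    rw [hφ, Finset.sum_sub_distrib, hind]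
    simp
    field_simp
    simp
  have hle (n : Fin m) : |φ n| ≤ 1 := by
    have h1 : P / m ≤ 1 := (div_le_one hm0).2 hPm
    have h0 : 0 ≤ P / m := by positivity
    simp only [hφ]
    rw [abs_le]
    split_ifs <;> constructor <;> linarith
  have hmain := huniv.abs_sum_le hsum hle A B
  have hcardZ : (Fintype.card ({a // a ∈ S} → Bool) : ℝ) = 2 ^ S.card := by simp
  have hfilter (hdec : DecidablePred fun q : X × I =>
      (fun s : {a // a ∈ S} => ((h q.2 q.1 : ℕ)).testBit s.1) = z) :
      ((@Finset.filter _ _ hdec (A ×ˢ B)).card : ℝ) =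
      ∑ i ∈ B, ∑ x ∈ A, φ (h i x) + A.card * B.card * (P / m) := by
    simp only [hcolor, hφ, Finset.sum_sub_distrib, Finset.sum_const, nsmul_eq_mul]
    rw [← Finset.sum_boole, Finset.sum_product_right]
    ring
  have hdigits : |P / m - 1 / 2 ^ S.card| ≤ 1 / √m := by
    have hD := Nat.abs_count_testBit_sub_le c hS m
    have hT : (2 : ℝ) ^ t ≤ √m := by
      refine Real.le_sqrt_of_sq_le ?_
      rw [← pow_mul, mul_comm, pow_mul]
      norm_num
      exact_mod_cast h4
    have hK : (1 : ℝ) ≤ 2 ^ S.card := one_le_pow₀ (by norm_num)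
    have hEq : P / m - 1 / 2 ^ S.card = (P * 2 ^ S.card - m) / (m * 2 ^ S.card) := by
      field_simp
    rw [hEq, abs_div, abs_of_pos (by positivity : (0 : ℝ) < m * 2 ^ S.card)]
    calc |P * 2 ^ S.card - m| / (m * 2 ^ S.card) ≤ √m / (m * 1) := by
          gcongr
          exact hD.trans hT
      _ = 1 / √m := by rw [mul_one, Real.sqrt_div_self, one_div]
  have hroot : √N / N ≤ N ^ (-(1 : ℝ) / 4) := by
    rw [Real.sqrt_div_self', one_div, Real.sqrt_eq_rpow, ← Real.rpow_neg (by linarith)]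
    exact Real.rpow_le_rpow_of_exponent_le hN0 (by norm_num)
  have hA : (A.card : ℝ) ≤ N := Nat.cast_le.2 <| Finset.card_le_univ A
  have hB : (B.card : ℝ) ≤ M := Nat.cast_le.2 <| Finset.card_le_univ B
  have hAB : (A.card : ℝ) * B.card / (N * M) ≤ 1 :=
    (div_le_one (by positivity)).2 (by gcongr)
  beta_reduce
  rw [hfilter, hcardZ]
  calc _ = |(∑ i ∈ B, ∑ x ∈ A, φ (h i x)) / (N * M) +
        A.card * B.card / (N * M) * (P / m - 1 / 2 ^ S.card)| := by
        congr 1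
        field_simp
        ring
    _ ≤ |∑ i ∈ B, ∑ x ∈ A, φ (h i x)| / (N * M) +
        A.card * B.card / (N * M) * |P / m - 1 / 2 ^ S.card| := by
        refine (abs_add_le _ _).trans_eq ?_
        rw [abs_div, abs_of_pos (by positivity : 0 < N * M), abs_mul,
          abs_of_nonneg (by positivity : 0 ≤ (A.card : ℝ) * B.card / (N * M))]
    _ ≤ M * √N / (N * M) + 1 * (1 / √m) := by gcongr
    _ = √N / N + 1 / √m := by
        field_simp
    _ ≤ N ^ (-(1 : ℝ) / 4) + 2 / √m := by
        gcongr
        norm_num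
end
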